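/- Let A be a bounded normal operator on a complex Hilbert space H with 0 ∈ spectrum(A). If the range of A is closed, then 0 is an isolated point of the spectrum of A. -/

import Mathlib

theorem isolated_zero_of_range_closed_of_normal
    {H : Type*} [NormedAddCommGroup H] [InnerProductSpace ℂ H] [CompleteSpace H]
    (A : H →L[ℂ] H)
    (hA : ContinuousLinearMap.adjoint A * A = A * ContinuousLinearMap.adjoint A)
    (h0 : (0 : ℂ) ∈ spectrum ℂ A)
    (hcl : IsClosed (Set.range ⇑A)) :
    ∃ ε > (0 : ℝ), ∀ lam ∈ spectrum ℂ A, ‖lam‖ < ε → lam = 0 := by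
  have hN : IsStarNormal A := ⟨hA⟩
  let R : Submodule ℂ H := A.range
  have hort : Rᗮ = A.ker := ContinuousLinearMap.IsStarNormal.orthogonal_range hN
  have hRc : IsClosed (R : Set H) := hcl
  have : CompleteSpace R := hRc.completeSpace_coe
  have hdec (y : H) : ∃ r ∈ R, ∃ k, A k = 0 ∧ y = r + k := by
    obtain ⟨r, hr, k, hk, rfl⟩ := R.exists_add_mem_mem_orthogonal y
    rw [hort] at hk
    exact ⟨r, hr, k, hk, rfl⟩
  have hmem (x : H) : A x ∈ R := ⟨x, rfl⟩
  let B : R →L[ℂ] R := (A.comp R.subtypeL).codRestrict R fun x => hmem x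
  have hB (x : R) : (B x : H) = A x := rfl
  have hBunit : IsUnit B := by
    rw [ContinuousLinearMap.isUnit_iff_bijective]
    constructor
    · rw [injective_iff_map_eq_zero]
      intro x hx
      have hk : (x : H) ∈ Rᗮ := by
        rw [hort]
        exact congrArg Subtype.val hx
      exact Subtype.ext (Submodule.disjoint_def.mp R.orthogonal_disjoint x x.2 hk)
    · rintro ⟨_, x, rfl⟩
      obtain ⟨r, hr, k, hk, rfl⟩ := hdec x
      exact ⟨⟨r, hr⟩, Subtype.ext (by simp [hB, hk])⟩
  have hB0 : (0 : ℂ) ∈ resolventSet ℂ B := by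
    rw [spectrum.mem_resolventSet_iff]
    rw [map_zero, zero_sub]
    exact hBunit.neg
  obtain ⟨ε, hε, hball⟩ := Metric.isOpen_iff.mp (spectrum.isOpen_resolventSet (𝕜 := ℂ) B) 0 hB0
  refine ⟨ε, hε, fun lam hlam hlt => ?_⟩
  by_contra hne
  have hu := hball (mem_ball_zero_iff.mpr hlt)
  rw [spectrum.mem_resolventSet_iff, ContinuousLinearMap.isUnit_iff_bijective] at hu
  apply hlam
  rw [spectrum.mem_resolventSet_iff, ContinuousLinearMap.isUnit_iff_bijective]
  have happ (x : H) : (algebraMap ℂ (H →L[ℂ] H) lam - A) x = lam • x - A x := by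
    simp [Algebra.algebraMap_eq_smul_one]
  have hBapp (x : R) : ((algebraMap ℂ (R →L[ℂ] R) lam - B) x : H) = lam • (x : H) - A x := by
    simp [Algebra.algebraMap_eq_smul_one, hB]
  constructor
  · rw [injective_iff_map_eq_zero]
    intro x hx
    rw [happ] at hx
    have hxR : x ∈ R := by
      rw [← R.smul_mem_iff hne, sub_eq_zero.mp hx]
      exact hmem x
    have hz := (injective_iff_map_eq_zero _).mp hu.1 ⟨x, hxR⟩
      (Subtype.ext ((hBapp ⟨x, hxR⟩).trans hx))
    exact congrArg Subtype.val hz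
  · intro y
    obtain ⟨r, hr, k, hk, rfl⟩ := hdec y
    obtain ⟨s, hs⟩ := hu.2 ⟨r, hr⟩
    have hs' : lam • (s : H) - A s = r := (hBapp s).symm.trans (congrArg Subtype.val hs)
    refine ⟨s + lam⁻¹ • k, ?_⟩
    rw [map_add, happ, happ, hs', map_smul, hk, smul_inv_smul₀ hne, smul_zero, sub_zero]
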